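/- Let C_f ⊂ (0,1) be a finite set and f : [0,1] \ C_f → [0,1] a local homeomorphism. If p ∈ [0,1] \ (B_0(f) ∪ O_f^-(Per(f))), then ω_f(p) is not contained in Per(f). -/

import Mathlib

open Set Filter Topology

/-- The ω-limit set of `x` under `f`. -/
def omegaSet (f : ℝ → ℝ) (x : ℝ) : Set ℝ :=
  {y | MapClusterPt y atTop (fun n => f^[n] x)}

def periodicPts (f : ℝ → ℝ) : Set ℝ := {p | ∃ n : ℕ, 1 ≤ n ∧ f^[n] p = p}

def preOrbit (f : ℝ → ℝ) (S : Set ℝ) : Set ℝ := ⋃ n : ℕ, f^[n] ⁻¹' S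

def LeftPeriodicLike (f : ℝ → ℝ) (p : ℝ) (ℓ : ℕ) : Prop :=
  1 ≤ ℓ ∧ Tendsto (f^[ℓ]) (𝓝[<] p) (𝓝[≤] p) ∧ Tendsto (f^[ℓ]) (𝓝[<] p) (𝓝 p)

def RightPeriodicLike (f : ℝ → ℝ) (p : ℝ) (ℓ : ℕ) : Prop :=
  1 ≤ ℓ ∧ Tendsto (f^[ℓ]) (𝓝[>] p) (𝓝[≥] p) ∧ Tendsto (f^[ℓ]) (𝓝[>] p) (𝓝 p)

def PeriodicLike (f : ℝ → ℝ) (p : ℝ) (ℓ : ℕ) : Prop :=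
  LeftPeriodicLike f p ℓ ∨ RightPeriodicLike f p ℓ

def basin0 (f : ℝ → ℝ) : Set ℝ :=
  {x | ∃ p ℓ, PeriodicLike f p ℓ ∧ Tendsto (fun k => f^[ℓ * k] x) atTop (𝓝 p)}

/-- The filter of right (`true`) or left (`false`) punctured neighbourhoods of `a`. -/
def sideNhds (s : Bool) (a : ℝ) : Filter ℝ := bif s then 𝓝[>] a else 𝓝[<] a

/-- `f` is continuous and injective on a neighbourhood of `x`. -/
def LocallyEmbedsAt (f : ℝ → ℝ) (x : ℝ) : Prop :=
  ∃ U ∈ 𝓝 x, ContinuousOn f U ∧ InjOn f U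

theorem LocallyEmbedsAt.continuousAt {f : ℝ → ℝ} {x : ℝ} (h : LocallyEmbedsAt f x) :
    ContinuousAt f x := by
  obtain ⟨U, hU, hc, -⟩ := h
  exact hc.continuousAt hU

theorem LocallyEmbedsAt.strictMonoOn_or_strictAntiOn {f : ℝ → ℝ} {x : ℝ}
    (h : LocallyEmbedsAt f x) :
    ∃ ε > 0, ContinuousOn f (Ioo (x - ε) (x + ε)) ∧
      (StrictMonoOn f (Ioo (x - ε) (x + ε)) ∨ StrictAntiOn f (Ioo (x - ε) (x + ε))) := by
  obtain ⟨U, hU, hc, hi⟩ := h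
  obtain ⟨ε, hε, hball⟩ := Metric.mem_nhds_iff.1 hU
  rw [Real.ball_eq_Ioo] at hball
  exact ⟨ε, hε, hc.mono hball,
    (hc.mono hball).strictMonoOn_of_injOn_Ioo (by linarith) (hi.mono hball)⟩

theorem LocallyEmbedsAt.not_isLocalExtr {f : ℝ → ℝ} {x : ℝ} (h : LocallyEmbedsAt f x) :
    ¬ IsLocalExtr f x := by
  obtain ⟨ε, hε, -, hmono⟩ := h.strictMonoOn_or_strictAntiOn
  have hx : x ∈ Ioo (x - ε) (x + ε) := by constructor <;> linarith
  have left : ∀ {P : ℝ → Prop}, (∀ᶠ y in 𝓝 x, P y) → ∃ y ∈ Ioo (x - ε) (x + ε), y < x ∧ P y := by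
    intro P hP
    obtain ⟨y, hy, hy'⟩ := ((hP.filter_mono nhdsWithin_le_nhds).and
      (Ioo_mem_nhdsLT (show x - ε < x by linarith))).exists
    exact ⟨y, ⟨hy'.1, hy'.2.trans hx.2⟩, hy'.2, hy⟩
  have right : ∀ {P : ℝ → Prop}, (∀ᶠ y in 𝓝 x, P y) → ∃ y ∈ Ioo (x - ε) (x + ε), x < y ∧ P y := by
    intro P hP
    obtain ⟨y, hy, hy'⟩ := ((hP.filter_mono nhdsWithin_le_nhds).and
      (Ioo_mem_nhdsGT (show x < x + ε by linarith))).exists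
    exact ⟨y, ⟨hx.1.trans hy'.1, hy'.2⟩, hy'.1, hy⟩
  rintro (hext | hext) <;> rcases hmono with hm | hm
  · obtain ⟨y, hy, hyx, h⟩ := left hext
    exact (hm hy hx hyx).not_ge h
  · obtain ⟨y, hy, hyx, h⟩ := right hext
    exact (hm hx hy hyx).not_ge h
  · obtain ⟨y, hy, hyx, h⟩ := right hext
    exact (hm hx hy hyx).not_ge h
  · obtain ⟨y, hy, hyx, h⟩ := left hext
    exact (hm hy hx hyx).not_ge h

theorem injOn_Ioo_of_locallyEmbedsAt {f : ℝ → ℝ} {a b : ℝ}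
    (h : ∀ x ∈ Ioo a b, LocallyEmbedsAt f x) : InjOn f (Ioo a b) := by
  have key : ∀ u ∈ Ioo a b, ∀ v ∈ Ioo a b, u < v → f u ≠ f v := by
    intro u hu v hv huv hf
    have hsub : Icc u v ⊆ Ioo a b := Icc_subset_Ioo hu.1 hv.2
    obtain ⟨c, hc, hext⟩ := exists_isLocalExtr_Ioo huv
      (fun x hx => (h x (hsub hx)).continuousAt.continuousWithinAt) hf
    exact (h c (hsub (Ioo_subset_Icc_self hc))).not_isLocalExtr hext
  intro u hu v hv huv
  rcases lt_trichotomy u v with hlt | heq | hlt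
  · exact absurd huv (key u hu v hv hlt)
  · exact heq
  · exact absurd huv.symm (key v hv u hu hlt)

theorem exists_tendsto_sideNhds_right {f : ℝ → ℝ} {a b : ℝ} (hab : a < b)
    (hloc : ∀ x ∈ Ioo a b, LocallyEmbedsAt f x) (hmaps : MapsTo f (Ioo a b) (Icc 0 1)) :
    ∃ t c, Tendsto f (𝓝[>] a) (sideNhds t c) := by
  have hne := nonempty_Ioo.2 hab
  have hbelow : BddBelow (f '' Ioo a b) := bddBelow_Icc.mono hmaps.image_subset
  have habove : BddAbove (f '' Ioo a b) := bddAbove_Icc.mono hmaps.image_subset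
  rcases ContinuousOn.strictMonoOn_of_injOn_Ioo hab
    (fun x hx => (hloc x hx).continuousAt.continuousWithinAt)
    (injOn_Ioo_of_locallyEmbedsAt hloc) with hm | hm
  · refine ⟨true, sInf (f '' Ioo a b), tendsto_nhdsWithin_iff.2
      ⟨hm.monotoneOn.tendsto_nhdsWithin_Ioo_right hne hbelow, ?_⟩⟩
    filter_upwards [Ioo_mem_nhdsGT hab] with x hx
    obtain ⟨y, hay, hyx⟩ := exists_between hx.1
    exact (csInf_le hbelow ⟨y, ⟨hay, hyx.trans hx.2⟩, rfl⟩).trans_lt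
      (hm ⟨hay, hyx.trans hx.2⟩ hx hyx)
  · refine ⟨false, sSup (f '' Ioo a b), tendsto_nhdsWithin_iff.2
      ⟨hm.antitoneOn.tendsto_nhdsWithin_Ioo_right hne habove, ?_⟩⟩
    filter_upwards [Ioo_mem_nhdsGT hab] with x hx
    obtain ⟨y, hay, hyx⟩ := exists_between hx.1
    exact (hm ⟨hay, hyx.trans hx.2⟩ hx hyx).trans_le
      (le_csSup habove ⟨y, ⟨hay, hyx.trans hx.2⟩, rfl⟩)

theorem exists_tendsto_sideNhds_left {f : ℝ → ℝ} {a b : ℝ} (hab : a < b)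
    (hloc : ∀ x ∈ Ioo a b, LocallyEmbedsAt f x) (hmaps : MapsTo f (Ioo a b) (Icc 0 1)) :
    ∃ t c, Tendsto f (𝓝[<] b) (sideNhds t c) := by
  have hne := nonempty_Ioo.2 hab
  have hbelow : BddBelow (f '' Ioo a b) := bddBelow_Icc.mono hmaps.image_subset
  have habove : BddAbove (f '' Ioo a b) := bddAbove_Icc.mono hmaps.image_subset
  rcases ContinuousOn.strictMonoOn_of_injOn_Ioo hab
    (fun x hx => (hloc x hx).continuousAt.continuousWithinAt)
    (injOn_Ioo_of_locallyEmbedsAt hloc) with hm | hm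
  · refine ⟨false, sSup (f '' Ioo a b), tendsto_nhdsWithin_iff.2
      ⟨hm.monotoneOn.tendsto_nhdsWithin_Ioo_left hne habove, ?_⟩⟩
    filter_upwards [Ioo_mem_nhdsLT hab] with x hx
    obtain ⟨y, hxy, hyb⟩ := exists_between hx.2
    exact (hm hx ⟨hx.1.trans hxy, hyb⟩ hxy).trans_le
      (le_csSup habove ⟨y, ⟨hx.1.trans hxy, hyb⟩, rfl⟩)
  · refine ⟨true, sInf (f '' Ioo a b), tendsto_nhdsWithin_iff.2
      ⟨hm.antitoneOn.tendsto_nhdsWithin_Ioo_left hne hbelow, ?_⟩⟩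
    filter_upwards [Ioo_mem_nhdsLT hab] with x hx
    obtain ⟨y, hxy, hyb⟩ := exists_between hx.2
    exact (csInf_le hbelow ⟨y, ⟨hx.1.trans hxy, hyb⟩, rfl⟩).trans_lt
      (hm hx ⟨hx.1.trans hxy, hyb⟩ hxy)

theorem sideNhds_le_nhds (s : Bool) (a : ℝ) : sideNhds s a ≤ 𝓝 a := by
  cases s <;> exact nhdsWithin_le_nhds

theorem disjoint_sideNhds {s t : Bool} {a b : ℝ} (h : (a, s) ≠ (b, t)) :
    Disjoint (sideNhds s a) (sideNhds t b) := by
  by_cases hab : a = b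
  · subst hab
    have hlr : Disjoint (𝓝[<] a) (𝓝[>] a) :=
      disjoint_of_disjoint_of_mem (Set.disjoint_left.2 fun x hx hx' =>
        lt_asymm (mem_Iio.1 hx) (mem_Ioi.1 hx')) self_mem_nhdsWithin self_mem_nhdsWithin
    cases s <;> cases t
    · exact absurd rfl h
    · exact hlr
    · exact hlr.symm
    · exact absurd rfl h
  · exact (disjoint_nhds_nhds.2 hab).mono (sideNhds_le_nhds s a) (sideNhds_le_nhds t b)

/-- An orbit that accumulates only on finitely many pairwise disjoint filters, which the map sends
to one another, accumulates on them periodically. -/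
theorem exists_periodic_tendsto_of_tendsto_iSup {X ι : Type*} [Finite ι] {f : X → X} {x : ℕ → X}
    (hx : ∀ n, x (n + 1) = f (x n)) {G : ι → Filter X} (hG : Pairwise (Function.onFun Disjoint G))
    {next : ι → ι} (hnext : ∀ i, Tendsto f (G i) (G (next i)))
    (hlim : Tendsto x atTop (⨆ i, G i)) :
    ∃ i ℓ, 1 ≤ ℓ ∧ next^[ℓ] i = i ∧ Tendsto (fun k => x (ℓ * k)) atTop (G i) := by
  obtain ⟨W, hW, hdisj⟩ := hG.exists_mem_filter_of_disjoint
  have hmem : ∀ᶠ n in atTop, ∃ i, x n ∈ W i ∧ f (x n) ∈ W (next i) := by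
    have : (⋃ i, W i ∩ f ⁻¹' W (next i)) ∈ ⨆ i, G i := by
      rw [mem_iSup]
      exact fun i => mem_of_superset (inter_mem (hW i) (hnext i (hW _)))
        (subset_iUnion (fun i => W i ∩ f ⁻¹' W (next i)) i)
    filter_upwards [hlim this] with n hn
    simpa using hn
  obtain ⟨N, hN⟩ := eventually_atTop.1 hmem
  have : Nonempty ι := ⟨(hN N le_rfl).choose⟩
  choose! γ hγ hγ' using hN
  have huniq : ∀ {y i j}, y ∈ W i → y ∈ W j → i = j := fun {y i j} hi hj => by
    by_contra hne
    exact Set.disjoint_left.1 (hdisj hne) hi hj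
  have hstep : ∀ n ≥ N, γ (n + 1) = next (γ n) := fun n hn =>
    huniq (hγ (n + 1) (by omega)) (hx n ▸ hγ' n hn)
  have hiter : ∀ n ≥ N, ∀ k, γ (n + k) = next^[k] (γ n) := by
    intro n hn k
    induction k with
    | zero => rfl
    | succ k ih => rw [Function.iterate_succ_apply', ← ih, ← hstep _ (by omega), add_assoc]
  obtain ⟨i, j, hij, heq⟩ : ∃ i j, i < j ∧ γ (N + i) = γ (N + j) := by
    obtain ⟨i, j, hne, heq⟩ := Finite.exists_ne_map_eq_of_infinite fun k => γ (N + k)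
    rcases lt_or_gt_of_ne hne with h | h
    exacts [⟨i, j, h, heq⟩, ⟨j, i, h, heq.symm⟩]
  obtain ⟨ℓ, rfl⟩ := Nat.exists_eq_add_of_lt hij
  set L := ℓ + 1 with hL
  have hper : ∀ n ≥ N + i, γ (n + L) = γ n := by
    intro n hn
    obtain ⟨d, rfl⟩ := Nat.exists_eq_add_of_le hn
    rw [hiter (N + i) (by omega) d, heq, ← hiter _ (by omega)]
    congr 1
    omega
  have hconst : ∀ k, γ (L * (N + i + k)) = γ (L * (N + i)) := by
    intro k
    induction k with
    | zero => rfl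
    | succ k ih =>
      rw [← ih, ← hper (L * (N + i + k)) (by nlinarith)]
      congr 1
  have hML : N + i ≤ L * (N + i) := by nlinarith
  refine ⟨γ (L * (N + i)), L, by omega, ?_, ?_⟩
  · rw [← hiter _ (by omega), hper _ hML]
  · have hsup : Tendsto (fun k => x (L * k)) atTop (⨆ i, G i) :=
      hlim.comp (tendsto_id.const_mul_atTop' (by omega))
    refine tendsto_def.2 fun U hU => ?_
    have hU' : (⋃ j, W j ∩ {y | j = γ (L * (N + i)) → y ∈ U}) ∈ ⨆ i, G i := by
      rw [mem_iSup]
      intro j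
      refine mem_of_superset ?_ (subset_iUnion _ j)
      by_cases hj : j = γ (L * (N + i))
      · exact inter_mem (hW j) (mem_of_superset (hj ▸ hU) fun y hy _ => hy)
      · exact mem_of_superset (hW j) fun y hy => ⟨hy, fun h => absurd h hj⟩
    filter_upwards [hsup.eventually hU', eventually_ge_atTop (N + i)] with k hk hkN
    obtain ⟨d, rfl⟩ := Nat.exists_eq_add_of_le hkN
    obtain ⟨j, hj, hjU⟩ := mem_iUnion.1 hk
    refine hjU (huniq hj ?_)
    rw [← hconst d]
    exact hγ _ (by nlinarith)

theorem exists_tendsto_sideNhds {f : ℝ → ℝ} {C : Set ℝ} (hCfin : C.Finite)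
    (hmaps : MapsTo f (Icc 0 1 \ C) (Icc 0 1)) (hloc : ∀ x ∈ Icc 0 1 \ C, LocallyEmbedsAt f x)
    {s : Bool} {a : ℝ} (ha : a ∈ Icc (0 : ℝ) 1)
    (hne : (𝓟 (Icc (0 : ℝ) 1) ⊓ sideNhds s a).NeBot) :
    ∃ t c, Tendsto f (sideNhds s a) (sideNhds t c) := by
  have hC : (C \ {a})ᶜ ∈ 𝓝 a := (hCfin.sdiff.isClosed.isOpen_compl).mem_nhds (by simp)
  cases s
  · obtain ⟨y, hy, hya⟩ := (hne.nonempty_of_mem (inter_mem_inf (mem_principal_self _)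
      (self_mem_nhdsWithin : Iio a ∈ 𝓝[<] a)))
    have h0a : 0 < a := hy.1.trans_lt hya
    obtain ⟨l, hl, hsub⟩ := (mem_nhdsLT_iff_exists_mem_Ico_Ioo_subset h0a).1
      (mem_nhdsWithin_of_mem_nhds hC)
    have hsub' : Ioo l a ⊆ Icc 0 1 \ C := fun x hx =>
      ⟨⟨hl.1.trans hx.1.le, hx.2.le.trans ha.2⟩, fun hxC => hsub hx ⟨hxC, hx.2.ne⟩⟩
    exact exists_tendsto_sideNhds_left hl.2 (fun x hx => hloc x (hsub' hx)) (hmaps.mono_left hsub')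
  · obtain ⟨y, hy, hya⟩ := (hne.nonempty_of_mem (inter_mem_inf (mem_principal_self _)
      (self_mem_nhdsWithin : Ioi a ∈ 𝓝[>] a)))
    have ha1 : a < 1 := lt_of_lt_of_le hya hy.2
    obtain ⟨l, hl, hsub⟩ := (mem_nhdsGT_iff_exists_mem_Ioc_Ioo_subset ha1).1
      (mem_nhdsWithin_of_mem_nhds hC)
    have hsub' : Ioo a l ⊆ Icc 0 1 \ C := fun x hx =>
      ⟨⟨ha.1.trans hx.1.le, hx.2.le.trans hl.2⟩, fun hxC => hsub hx ⟨hxC, hx.1.ne'⟩⟩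
    exact exists_tendsto_sideNhds_right hl.1 (fun x hx => hloc x (hsub' hx)) (hmaps.mono_left hsub')

theorem periodicLike_of_tendsto_sideNhds {f : ℝ → ℝ} {a : ℝ} {s : Bool} {ℓ : ℕ} (hℓ : 1 ≤ ℓ)
    (h : Tendsto f^[ℓ] (sideNhds s a) (sideNhds s a)) : PeriodicLike f a ℓ := by
  cases s
  · exact Or.inl ⟨hℓ, h.mono_right (nhdsWithin_mono _ Iio_subset_Iic_self),
      h.mono_right nhdsWithin_le_nhds⟩
  · exact Or.inr ⟨hℓ, h.mono_right (nhdsWithin_mono _ Ioi_subset_Ici_self),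
      h.mono_right nhdsWithin_le_nhds⟩

theorem omegaSet_subset_of_isClosed {f : ℝ → ℝ} {p : ℝ} {K : Set ℝ} (hK : IsClosed K)
    (h : ∀ n, f^[n] p ∈ K) : omegaSet f p ⊆ K := fun _ ha =>
  hK.closure_eq ▸ mem_closure_iff_clusterPt.2
    (ClusterPt.mono ha (le_principal_iff.2 (mem_map.2 (Eventually.of_forall h))))

theorem isClosed_omegaSet (f : ℝ → ℝ) (p : ℝ) : IsClosed (omegaSet f p) :=
  isClosed_setOfPred_clusterPt

theorem Ultrafilter.exists_le_sideNhds {u : Ultrafilter ℝ} {a : ℝ} (hua : (u : Filter ℝ) ≤ 𝓝 a)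
    (hne : {a}ᶜ ∈ u) : ∃ s, (u : Filter ℝ) ≤ sideNhds s a := by
  have : Iio a ∪ Ioi a ∈ u := by rwa [Iio_union_Ioi]
  rcases Ultrafilter.union_mem_iff.1 this with h | h
  · exact ⟨false, le_inf hua (le_principal_iff.2 h)⟩
  · exact ⟨true, le_inf hua (le_principal_iff.2 h)⟩

/-- An orbit with finite ω-limit set that never meets this set is in the basin of a periodic-like
orbit. -/
theorem mem_basin0_of_finite_omegaSet {f : ℝ → ℝ} {C : Set ℝ} (hCfin : C.Finite)
    (hmaps : MapsTo f (Icc 0 1 \ C) (Icc 0 1)) (hloc : ∀ x ∈ Icc 0 1 \ C, LocallyEmbedsAt f x)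
    {p : ℝ} (hp : ∀ n, f^[n] p ∈ Icc (0 : ℝ) 1) (hω : ∀ n, f^[n] p ∉ omegaSet f p)
    (hfin : (omegaSet f p).Finite) : p ∈ basin0 f := by
  set x : ℕ → ℝ := fun n => f^[n] p with hx
  have hx01 : map x atTop ≤ 𝓟 (Icc 0 1) := le_principal_iff.2 (mem_map.2 (Eventually.of_forall hp))
  have hω01 : omegaSet f p ⊆ Icc 0 1 := omegaSet_subset_of_isClosed isClosed_Icc hp
  have hxf : ∀ n, x (n + 1) = f (x n) := fun n => Function.iterate_succ_apply' f n p
  let T : Set (ℝ × Bool) := {g | (map x atTop ⊓ sideNhds g.2 g.1).NeBot}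
  have hTω : ∀ g ∈ T, g.1 ∈ omegaSet f p := fun g hg =>
    (hg.mono (le_inf (inf_le_right.trans (sideNhds_le_nhds _ _)) inf_le_left) :
      (𝓝 g.1 ⊓ map x atTop).NeBot)
  have hTfin : T.Finite := (hfin.prod finite_univ).subset fun g hg => ⟨hTω g hg, mem_univ _⟩
  have : Finite T := hTfin
  have hnext : ∀ g : T, ∃ g' : T, Tendsto f (sideNhds g.1.2 g.1.1) (sideNhds g'.1.2 g'.1.1) := by
    rintro ⟨⟨a, s⟩, hg⟩
    obtain ⟨t, c, htc⟩ := exists_tendsto_sideNhds hCfin hmaps hloc (hω01 (hTω _ hg))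
      (hg.mono (inf_le_inf_right _ hx01))
    have hmap : map f (map x atTop) ≤ map x atTop := by
      rw [map_map, show f ∘ x = x ∘ (· + 1) from funext fun n => (hxf n).symm, ← map_map]
      exact map_mono (tendsto_add_atTop_nat 1)
    exact ⟨⟨(c, t), (hg.map f).mono (map_inf_le.trans (inf_le_inf hmap htc))⟩, htc⟩
  choose next hnext using hnext
  have hlim : Tendsto x atTop (⨆ g : T, sideNhds g.1.2 g.1.1) := by
    refine le_iff_ultrafilter.2 fun u hu => ?_
    obtain ⟨a, -, hua⟩ := isCompact_Icc.ultrafilter_le_nhds u (hu.trans hx01)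
    have haω : a ∈ omegaSet f p := u.neBot.mono (le_inf hua hu)
    obtain ⟨s, hs⟩ := Ultrafilter.exists_le_sideNhds hua <|
      hu (mem_map.2 (Eventually.of_forall fun n (h : x n = a) => hω n (h.symm ▸ haω : x n ∈ _)))
    exact hs.trans (le_iSup (fun g : T => sideNhds g.1.2 g.1.1)
      ⟨(a, s), u.neBot.mono (le_inf hu hs)⟩)
  obtain ⟨i, ℓ, hℓ, hi, hconv⟩ := exists_periodic_tendsto_of_tendsto_iSup hxf
    (fun i j hij => disjoint_sideNhds fun h => hij (Subtype.ext h)) hnext hlim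
  have hiter : ∀ n, Tendsto f^[n] (sideNhds i.1.2 i.1.1)
      (sideNhds (next^[n] i).1.2 (next^[n] i).1.1) := by
    intro n
    induction n with
    | zero => exact tendsto_id
    | succ n ih =>
      rw [Function.iterate_succ', Function.iterate_succ_apply']
      exact (hnext _).comp ih
  refine ⟨i.1.1, ℓ, periodicLike_of_tendsto_sideNhds (s := i.1.2) hℓ ?_,
    hconv.mono_right (sideNhds_le_nhds _ _)⟩
  simpa only [hi] using hiter ℓ

theorem LocallyEmbedsAt.comp {f g : ℝ → ℝ} {x : ℝ} (hg : LocallyEmbedsAt g (f x))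
    (hf : LocallyEmbedsAt f x) : LocallyEmbedsAt (g ∘ f) x := by
  have hcont := hf.continuousAt
  obtain ⟨U, hU, hfc, hfi⟩ := hf
  obtain ⟨V, hV, hgc, hgi⟩ := hg
  exact ⟨U ∩ f ⁻¹' V, inter_mem hU (hcont hV),
    hgc.comp (hfc.mono inter_subset_left) fun _ h => h.2,
    hgi.comp (hfi.mono inter_subset_left) fun _ h => h.2⟩

theorem LocallyEmbedsAt.iterate {f : ℝ → ℝ} {x : ℝ} (h : ∀ i, LocallyEmbedsAt f (f^[i] x))
    (n : ℕ) : LocallyEmbedsAt f^[n] x := by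
  induction n with
  | zero => exact ⟨univ, univ_mem, continuousOn_id, injOn_id _⟩
  | succ n ih =>
    rw [Function.iterate_succ']
    exact (h n).comp ih

theorem exists_tendsto_of_monotone_or_antitone {z : ℕ → ℝ} {a b : ℝ} (hz : ∀ j, z j ∈ Icc a b)
    (h : Monotone z ∨ Antitone z) : ∃ r ∈ Icc a b, Tendsto z atTop (𝓝 r) := by
  obtain ⟨r, hr⟩ : ∃ r, Tendsto z atTop (𝓝 r) := by
    rcases h with h | h
    · exact ⟨_, tendsto_atTop_ciSup h ⟨b, by rintro _ ⟨j, rfl⟩; exact (hz j).2⟩⟩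
    · exact ⟨_, tendsto_atTop_ciInf h ⟨a, by rintro _ ⟨j, rfl⟩; exact (hz j).1⟩⟩
  exact ⟨r, isClosed_Icc.mem_of_tendsto hr (Eventually.of_forall hz), hr⟩

/-- Near a right-sided accumulation point `a` of the sequence `x`, fixed by the monotone map `g`
which shifts `x` by `m`, the sequence has a convergent subprogression, provided that the
accumulation points of `x` near `a` are fixed by `g`. -/
theorem exists_tendsto_progression_right {g : ℝ → ℝ} {x : ℕ → ℝ} {m : ℕ} {a b : ℝ} (hab : a < b)
    (hg : MonotoneOn g (Icc a b)) (hgc : ContinuousAt g a) (hga : g a = a)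
    (hx : ∀ n, x (n + m) = g (x n)) (hfix : ∀ y ∈ Icc a b, MapClusterPt y atTop x → g y = y)
    (hacc : (map x atTop ⊓ 𝓝[>] a).NeBot) :
    ∃ k, ∃ r ∈ Icc a b, Tendsto (fun j => x (k + m * j)) atTop (𝓝 r) := by
  have hfreq : ∀ c, a < c → ∃ᶠ n in atTop, x n ∈ Ioo a c := fun c hc =>
    frequently_map.1 ((frequently_mem_iff_neBot (l := map x atTop)).2
      (hacc.mono (inf_le_inf_left _ (le_principal_iff.2 (Ioo_mem_nhdsGT hc)))))
  have hstep : ∀ k j, x (k + m * (j + 1)) = g (x (k + m * j)) := fun k j => by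
    rw [← hx, mul_add_one, add_assoc]
  have conclude : ∀ k, (∀ j, x (k + m * j) ∈ Icc a b) →
      ∃ k, ∃ r ∈ Icc a b, Tendsto (fun j => x (k + m * j)) atTop (𝓝 r) := by
    intro k hk
    obtain ⟨r, hr, hlim⟩ := exists_tendsto_of_monotone_or_antitone hk <| by
      rcases le_total (x (k + m * 0)) (x (k + m * (0 + 1))) with h | h
      · left
        refine monotone_nat_of_le_succ fun j => ?_
        induction j with
        | zero => exact h
        | succ j ih =>
          rw [hstep k j, hstep k (j + 1)]
          exact hg (hk _) (hk _) ih
      · right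
        refine antitone_nat_of_succ_le fun j => ?_
        induction j with
        | zero => exact h
        | succ j ih =>
          rw [hstep k j, hstep k (j + 1)]
          exact hg (hk _) (hk _) ih
    exact ⟨k, r, hr, hlim⟩
  by_cases hc : ∃ c ∈ Ioc a b, g c ≤ c
  · obtain ⟨c, hc, hgc⟩ := hc
    obtain ⟨k, hk⟩ := (hfreq c hc.1).exists
    have hmem : ∀ j, x (k + m * j) ∈ Icc a c := by
      intro j
      induction j with
      | zero => exact Ioo_subset_Icc_self hk
      | succ j ih =>
        have ih' : x (k + m * j) ∈ Icc a b := ⟨ih.1, ih.2.trans hc.2⟩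
        rw [hstep]
        exact ⟨hga.symm.trans_le (hg (left_mem_Icc.2 hab.le) ih' ih.1),
          (hg ih' (Ioc_subset_Icc_self hc) ih.2).trans hgc⟩
    exact conclude k fun j => ⟨(hmem j).1, (hmem j).2.trans hc.2⟩
  · push Not at hc
    obtain ⟨z, hzb, hz⟩ : ∃ z, g z < b ∧ z ∈ Ioo a b :=
      (((hgc.eventually_lt_const (hga.trans_lt hab)).filter_mono nhdsWithin_le_nhds).and
        (Ioo_mem_nhdsGT hab)).exists
    by_cases hstay : ∃ k, ∀ j, x (k + m * j) ∈ Ioo a z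
    · obtain ⟨k, hk⟩ := hstay
      exact conclude k fun j => ⟨(hk j).1.le, (hk j).2.le.trans hz.2.le⟩
    · push Not at hstay
      have hhit : ∃ᶠ n in atTop, x n ∈ Icc z (g z) := by
        refine frequently_atTop.2 fun N => ?_
        obtain ⟨k, hkN, hk⟩ := frequently_atTop.1 (hfreq z hz.1) N
        classical
        have hspec := Nat.find_spec (hstay k)
        have hmin : ∀ j < Nat.find (hstay k), x (k + m * j) ∈ Ioo a z :=
          fun j hj => not_not.1 (Nat.find_min (hstay k) hj)
        obtain ⟨j, hj⟩ : ∃ j, Nat.find (hstay k) = j + 1 := by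
          refine Nat.exists_eq_succ_of_ne_zero fun h0 => ?_
          rw [h0] at hspec
          exact hspec hk
        have hin := hmin j (by omega)
        have hin' : x (k + m * j) ∈ Icc a b := ⟨hin.1.le, hin.2.le.trans hz.2.le⟩
        have hlt : a < x (k + m * (j + 1)) := by
          rw [hstep]
          exact hin.1.trans (hc _ ⟨hin.1, hin'.2⟩)
        rw [hj] at hspec
        refine ⟨k + m * (j + 1), by omega, not_lt.1 fun h => hspec ⟨hlt, h⟩, ?_⟩
        rw [hstep]
        exact hg hin' (Ioo_subset_Icc_self hz) hin.2.le
      obtain ⟨y, hy, hyx⟩ := isCompact_Icc.exists_mapClusterPt_of_frequently hhit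
      have hyab : y ∈ Ioc a b := ⟨hz.1.trans_le hy.1, hy.2.trans hzb.le⟩
      exact absurd (hfix y (Ioc_subset_Icc_self hyab) hyx) (hc y hyab).ne'

theorem exists_tendsto_progression_left {g : ℝ → ℝ} {x : ℕ → ℝ} {m : ℕ} {a b : ℝ} (hab : a < b)
    (hg : MonotoneOn g (Icc a b)) (hgc : ContinuousAt g b) (hgb : g b = b)
    (hx : ∀ n, x (n + m) = g (x n)) (hfix : ∀ y ∈ Icc a b, MapClusterPt y atTop x → g y = y)
    (hacc : (map x atTop ⊓ 𝓝[<] b).NeBot) :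
    ∃ k, ∃ r ∈ Icc a b, Tendsto (fun j => x (k + m * j)) atTop (𝓝 r) := by
  have hneg : ∀ {y}, y ∈ Icc (-b) (-a) → -y ∈ Icc a b := fun hy =>
    ⟨le_neg_of_le_neg hy.2, neg_le_of_neg_le hy.1⟩
  obtain ⟨k, r, hr, hlim⟩ := exists_tendsto_progression_right (g := fun y => -g (-y))
    (x := fun n => -x n) (m := m) (neg_lt_neg hab)
    (fun y hy z hz hyz => neg_le_neg (hg (hneg hz) (hneg hy) (neg_le_neg hyz)))
    ((ContinuousAt.comp (by simpa using hgc) continuous_neg.continuousAt).neg)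
    (by simp [hgb]) (fun n => by simp [hx])
    (fun y hy hyx => by
      have hyx' := MapClusterPt.continuousAt_comp (f := Neg.neg) continuous_neg.continuousAt hyx
      simp only [Function.comp_def, neg_neg] at hyx'
      rw [hfix (-y) (hneg hy) hyx', neg_neg])
    ((hacc.map Neg.neg).mono (map_inf_le.trans (inf_le_inf map_map.le tendsto_neg_nhdsLT)))
  exact ⟨k, -r, hneg hr, by simpa using hlim.neg⟩

/-- If a subprogression of an orbit converges to a point at which all iterates are continuous, then
the ω-limit set is finite. -/
theorem finite_omegaSet_of_tendsto {f : ℝ → ℝ} {p r : ℝ} {k m : ℕ} (hm : 1 ≤ m)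
    (hcont : ∀ i, ContinuousAt f^[i] r)
    (hlim : Tendsto (fun j => f^[k + m * j] p) atTop (𝓝 r)) : (omegaSet f p).Finite := by
  have hTfin : ((fun i => f^[i] r) '' Iio m).Finite := (finite_Iio m).image _
  refine hTfin.subset fun y hy => ?_
  by_contra hyT
  have hconv : Tendsto (fun n => f^[n] p) atTop (𝓝ˢ ((fun i => f^[i] r) '' Iio m)) := by
    refine tendsto_def.2 fun U hU => ?_
    have hev : ∀ i ∈ Iio m, ∀ᶠ j in atTop, f^[i + (k + m * j)] p ∈ U := fun i hi => by
      simp only [Function.iterate_add_apply f i]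
      exact ((hcont i).tendsto.comp hlim) (mem_nhdsSet_iff_forall.1 hU _ ⟨i, hi, rfl⟩)
    obtain ⟨J, hJ⟩ := eventually_atTop.1 ((finite_Iio m).eventually_all.2 hev)
    filter_upwards [eventually_ge_atTop (k + m * J)] with n hn
    have hdiv := Nat.mod_add_div (n - k) m
    have hJle : J ≤ (n - k) / m := (Nat.le_div_iff_mul_le (by omega)).2 (by
      rw [mul_comm]; omega)
    have := hJ _ hJle _ (Nat.mod_lt (n - k) (by omega))
    rwa [show (n - k) % m + (k + m * ((n - k) / m)) = n by omega] at this
  have hdisj : Disjoint (𝓝 y) (𝓝ˢ ((fun i => f^[i] r) '' Iio m)) :=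
    disjoint_nhds_nhdsSet.2 (hTfin.isClosed.closure_eq.symm ▸ hyT)
  exact hy.ne (disjoint_iff.1 (hdisj.mono_right hconv))

theorem finite_periodicPts_inter_preOrbit (f : ℝ → ℝ) {C : Set ℝ} (hC : C.Finite) :
    (periodicPts f ∩ preOrbit f C).Finite := by
  refine (hC.biUnion fun c _ => (finite_Iio (Function.minimalPeriod f c)).image
    fun i => f^[i] c).subset ?_
  rintro a ⟨⟨n, hn, hna⟩, ha⟩
  obtain ⟨i, hi⟩ := mem_iUnion.1 ha
  have hper : Function.IsPeriodicPt f n a := hna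
  have hcper : Function.IsPeriodicPt f n (f^[i] a) := hper.apply_iterate i
  refine mem_biUnion hi ⟨(n * i - i) % Function.minimalPeriod f (f^[i] a),
    Nat.mod_lt _ (hcper.minimalPeriod_pos hn), ?_⟩
  simp only [Function.iterate_mod_minimalPeriod_eq]
  rw [← Function.iterate_add_apply, Nat.sub_add_cancel (Nat.le_mul_of_pos_left i hn)]
  exact hper.mul_const i

/-- On a nonempty locally closed set of periodic points at which all iterates are continuous, the
period is locally constant somewhere. -/
theorem exists_eventually_iterate_eq {f : ℝ → ℝ} {S : Set ℝ} (hS : IsLocallyClosed S)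
    (hne : S.Nonempty) (hper : S ⊆ periodicPts f) (hcont : ∀ y ∈ S, ∀ n, ContinuousAt f^[n] y) :
    ∃ q ∈ S, ∃ n, 1 ≤ n ∧ ∀ᶠ y in 𝓝 q, y ∈ S → f^[n] y = y := by
  have := hS.locallyCompactSpace
  have := hne.to_subtype
  obtain ⟨n, ⟨q, hq⟩, hqn⟩ := nonempty_interior_of_iUnion_of_closed
    (f := fun n : ℕ => {y : S | f^[n + 1] y = y})
    (fun n => isClosed_eq (continuous_iff_continuousAt.2 fun y =>
      (hcont y y.2 (n + 1)).comp continuous_subtype_val.continuousAt) continuous_subtype_val)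
    (eq_univ_of_forall fun y => by
      obtain ⟨n, hn, hny⟩ := hper y.2
      exact mem_iUnion.2 ⟨n - 1, by rwa [mem_ofPred_eq, Nat.sub_add_cancel hn]⟩)
  have hqn' := mem_interior_iff_mem_nhds.1 hqn
  rw [mem_nhds_subtype_iff_nhdsWithin, mem_nhdsWithin_iff_eventually] at hqn'
  refine ⟨q, hq, n + 1, by omega, hqn'.mono fun y hy hyS => ?_⟩
  obtain ⟨z, hz, rfl⟩ := hy hyS
  exact hz

/-- If `f^[n]` fixes the points of an ω-limit set near a point `q` of it and is a local embedding at
`q`, then some subprogression of the orbit converges to a point near `q`. -/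
theorem exists_tendsto_progression {f : ℝ → ℝ} {p q : ℝ} {n : ℕ} {W : Set ℝ}
    (hq : q ∈ omegaSet f p) (hω : ∀ n, f^[n] p ∉ omegaSet f p) (hW : W ∈ 𝓝 q)
    (hfix : ∀ y ∈ W ∩ omegaSet f p, f^[n] y = y) (hemb : LocallyEmbedsAt f^[n] q) :
    ∃ k, ∃ r ∈ W, Tendsto (fun j => f^[k + 2 * n * j] p) atTop (𝓝 r) := by
  have hcont := hemb.continuousAt
  have hqn : f^[n] q = q := hfix q ⟨mem_of_mem_nhds hW, hq⟩
  obtain ⟨ε, hε, -, hmono⟩ := hemb.strictMonoOn_or_strictAntiOn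
  set I := Ioo (q - ε) (q + ε)
  have hI : I ∈ 𝓝 q := Ioo_mem_nhds (by linarith) (by linarith)
  obtain ⟨δ, hδ, hsub⟩ := Metric.nhds_basis_closedBall.mem_iff.1
    (inter_mem (inter_mem hI (hcont.preimage_mem_nhds (by rwa [hqn]))) hW)
  rw [Real.closedBall_eq_Icc] at hsub
  have hIsub : Icc (q - δ) (q + δ) ⊆ I := fun y hy => (hsub hy).1.1
  have hmaps : MapsTo f^[n] (Icc (q - δ) (q + δ)) I := fun y hy => (hsub hy).1.2
  have h2 : f^[2 * n] = f^[n] ∘ f^[n] := by rw [two_mul, Function.iterate_add]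
  have hg : MonotoneOn f^[2 * n] (Icc (q - δ) (q + δ)) := by
    rw [h2]
    rcases hmono with h | h
    · exact (h.comp (h.mono hIsub) hmaps).monotoneOn
    · exact (h.comp (h.mono hIsub) hmaps).monotoneOn
  have hgq : f^[2 * n] q = q := by rw [h2, Function.comp_apply, hqn, hqn]
  have hgc : ContinuousAt f^[2 * n] q := by
    rw [h2]
    exact ContinuousAt.comp (by rwa [hqn]) hcont
  have hgfix : ∀ y ∈ Icc (q - δ) (q + δ), MapClusterPt y atTop (fun n => f^[n] p) →
      f^[2 * n] y = y := fun y hy hyω => by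
    have := hfix y ⟨(hsub hy).2, hyω⟩
    rw [h2, Function.comp_apply, this, this]
  have hshift : ∀ j, f^[j + 2 * n] p = f^[2 * n] (f^[j] p) := fun j => by
    rw [add_comm, Function.iterate_add_apply]
  obtain ⟨u, hu⟩ := exists_ultrafilter_iff.2 (hq : (𝓝 q ⊓ map (fun n => f^[n] p) atTop).NeBot)
  have huq := hu.trans inf_le_left
  have hux := hu.trans inf_le_right
  obtain ⟨s, hs⟩ := Ultrafilter.exists_le_sideNhds huq <|
    hux (mem_map.2 (Eventually.of_forall fun n (h : f^[n] p = q) => hω n (h.symm ▸ hq)))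
  have hacc : (map (fun n => f^[n] p) atTop ⊓ sideNhds s q).NeBot := u.neBot.mono (le_inf hux hs)
  have hleft : Icc (q - δ) q ⊆ Icc (q - δ) (q + δ) := Icc_subset_Icc_right (by linarith)
  have hright : Icc q (q + δ) ⊆ Icc (q - δ) (q + δ) := Icc_subset_Icc_left (by linarith)
  cases s
  · obtain ⟨k, r, hr, hlim⟩ := exists_tendsto_progression_left (by linarith) (hg.mono hleft) hgc hgq
      hshift (fun y hy => hgfix y (hleft hy)) hacc
    exact ⟨k, r, (hsub (hleft hr)).2, hlim⟩
  · obtain ⟨k, r, hr, hlim⟩ := exists_tendsto_progression_right (by linarith) (hg.mono hright) hgc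
      hgq hshift (fun y hy => hgfix y (hright hy)) hacc
    exact ⟨k, r, (hsub (hright hr)).2, hlim⟩

/-- Let `C ⊂ (0,1)` be finite and `f : [0,1] \ C → [0,1]` a local
homeomorphism. If `p ∈ [0,1] \ (B₀(f) ∪ O_f⁻(Per(f)))` (with its orbit
avoiding `C`), then `ω_f(p)` is not contained in `Per(f)`. -/
theorem omega_not_subset_periodic (f : ℝ → ℝ) (C : Set ℝ)
    (hCfin : C.Finite) (hC : C ⊆ Set.Ioo 0 1)
    (hmaps : Set.MapsTo f (Set.Icc 0 1 \ C) (Set.Icc 0 1))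
    (hloc : ∀ x ∈ Set.Icc 0 1 \ C, ∃ ε > 0,
      ContinuousOn f (Metric.ball x ε) ∧ Set.InjOn f (Metric.ball x ε))
    (p : ℝ) (hp : p ∈ Set.Icc 0 1 \ (basin0 f ∪ preOrbit f (periodicPts f)))
    (hpC : ∀ n : ℕ, f^[n] p ∉ C) :
    ¬ (omegaSet f p ⊆ periodicPts f) := by
  have hloc' : ∀ x ∈ Icc 0 1 \ C, LocallyEmbedsAt f x := fun x hx => by
    obtain ⟨ε, hε, h⟩ := hloc x hx
    exact ⟨_, Metric.ball_mem_nhds x hε, h⟩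
  have horb : ∀ y ∈ Icc (0 : ℝ) 1, (∀ i, f^[i] y ∉ C) → ∀ i, f^[i] y ∈ Icc 0 1 \ C := by
    intro y hy hyC i
    refine ⟨?_, hyC i⟩
    induction i with
    | zero => exact hy
    | succ i ih =>
      rw [Function.iterate_succ_apply']
      exact hmaps ⟨ih, hyC i⟩
  have hp01 : ∀ n, f^[n] p ∈ Icc (0 : ℝ) 1 := fun n => (horb p hp.1 hpC n).1
  intro hper
  have hω : ∀ n, f^[n] p ∉ omegaSet f p := fun n h =>
    hp.2 (Or.inr (mem_iUnion.2 ⟨n, hper h⟩))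
  have hinf : (omegaSet f p).Infinite := fun hfin =>
    hp.2 (Or.inl (mem_basin0_of_finite_omegaSet hCfin hmaps hloc' hp01 hω hfin))
  set F := periodicPts f ∩ preOrbit f C
  have hF : F.Finite := finite_periodicPts_inter_preOrbit f hCfin
  have hemb : ∀ y ∈ omegaSet f p \ F, ∀ n, LocallyEmbedsAt f^[n] y := fun y hy =>
    LocallyEmbedsAt.iterate fun i => hloc' _ <|
      horb y (omegaSet_subset_of_isClosed isClosed_Icc hp01 hy.1)
        (fun i hi => hy.2 ⟨hper hy.1, mem_iUnion.2 ⟨i, hi⟩⟩) i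
  obtain ⟨q, hq, n, hn, hqn⟩ := exists_eventually_iterate_eq
    ((isClosed_omegaSet f p).isLocallyClosed.inter hF.isClosed.isOpen_compl.isLocallyClosed)
    (hinf.sdiff hF).nonempty (fun y hy => hper hy.1) (fun y hy n => (hemb y hy n).continuousAt)
  obtain ⟨k, r, hr, hlim⟩ := exists_tendsto_progression hq.1 hω
    (inter_mem hqn (hF.isClosed.isOpen_compl.mem_nhds hq.2))
    (fun y hy => hy.1.1 ⟨hy.2, hy.1.2⟩) (hemb q hq n)
  have hrω : r ∈ omegaSet f p :=
    hlim.mapClusterPt.of_comp (φ := fun j => k + 2 * n * j) (tendsto_atTop_mono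
      (fun j => le_add_left (Nat.le_mul_of_pos_left j (by omega))) tendsto_id)
  exact hinf (finite_omegaSet_of_tendsto (show 1 ≤ 2 * n by omega)
    (fun i => (hemb r ⟨hrω, hr.2⟩ i).continuousAt) hlim)
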